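/- arXiv:2510.08708 — 8 statements merged into one kernel-verified Lean document; each statement's English description precedes it below -/
import Mathlib

section
/- Let n ≥ 1 and r be integers with n ≡ r (mod 2), and let g be a 2×2 complex matrix with w₂(g) ≠ 0 and w₂′(g) ≠ 0. Then the function φ_r^n satisfies the following equivariance properties (all products are matrix products, and the translated matrices again have nonvanishing w₂ and w₂′): (i) for every u ∈ ℝ, with N_u = [[1 − u/(2i), u/(2i)], [−u/(2i), 1 + u/(2i)]], one has φ_r^n(N_u · g) = φ_r^n(g); (ii) for every t ∈ ℝ and every nonzero λ ∈ ℝ, with h_t = [[cosh t, sinh t], [sinh t, cosh t]], one has φ_r^n((λ · h_t) · g) = e^{(n+2)t} · λ^{−n} · φ_r^n(g); (iii) for every nonzero τ ∈ ℂ, one has φ_r^n(g · [[τ, 0], [0, conj(τ)]]) = τ^{−(n+r)/2} · conj(τ)^{−(n−r)/2} · φ_r^n(g). (This realizes the paper's Proposition that φ_r^n lies in the induced representation Ind_{B₂(ℝ)⁺}^{GL₂(ℝ)⁺} λ(n+2, −n) and has weight λ′(−r, −n) under the compact torus.) -/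
open Matrix Complex

noncomputable def w2 (g : Matrix (Fin 2) (Fin 2) ℂ) : ℂ := -g 0 1 + g 1 1

noncomputable def w2' (g : Matrix (Fin 2) (Fin 2) ℂ) : ℂ := g 0 0 - g 1 0

noncomputable def z2 (g : Matrix (Fin 2) (Fin 2) ℂ) : ℂ :=
  Complex.I * (g 0 1 + g 1 1) / (-g 0 1 + g 1 1)

noncomputable def z2' (g : Matrix (Fin 2) (Fin 2) ℂ) : ℂ :=
  Complex.I * (g 0 0 + g 1 0) / (-g 0 0 + g 1 0)

/-- The function `φ_r^n = (z₂ − z₂′) · w₂^{−(n−r)/2} · w₂′^{−(n+r)/2}`. -/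
noncomputable def phi (n r : ℤ) (g : Matrix (Fin 2) (Fin 2) ℂ) : ℂ :=
  (z2 g - z2' g) * w2 g ^ (-((n - r) / 2)) * w2' g ^ (-((n + r) / 2))

/-- The unipotent matrix `N_u`. -/
noncomputable def Nmat (u : ℝ) : Matrix (Fin 2) (Fin 2) ℂ :=
  !![1 - (u : ℂ) / (2 * Complex.I), (u : ℂ) / (2 * Complex.I);
     -((u : ℂ) / (2 * Complex.I)), 1 + (u : ℂ) / (2 * Complex.I)]

/-- The hyperbolic torus matrix `h_t`. -/
noncomputable def hmat (t : ℝ) : Matrix (Fin 2) (Fin 2) ℂ :=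
  !![(Real.cosh t : ℂ), (Real.sinh t : ℂ); (Real.sinh t : ℂ), (Real.cosh t : ℂ)]

lemma w2_Nmat_mul (u : ℝ) (g : Matrix (Fin 2) (Fin 2) ℂ) : w2 (Nmat u * g) = w2 g := by
  simp [w2, Nmat, Matrix.mul_apply, Fin.sum_univ_two]
  ring

lemma w2'_Nmat_mul (u : ℝ) (g : Matrix (Fin 2) (Fin 2) ℂ) : w2' (Nmat u * g) = w2' g := by
  simp [w2', Nmat, Matrix.mul_apply, Fin.sum_univ_two]
  ring

lemma z2_Nmat_mul (u : ℝ) (g : Matrix (Fin 2) (Fin 2) ℂ) (hw : w2 g ≠ 0) :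
    z2 (Nmat u * g) = z2 g + u := by
  have h := w2_Nmat_mul u g
  unfold w2 at h hw
  unfold z2
  rw [h, div_add' _ _ _ hw]
  congr 1
  simp only [Nmat, Matrix.mul_apply, Fin.sum_univ_two, of_apply, cons_val', cons_val_zero,
    cons_val_one, cons_val_fin_one]
  field_simp [I_ne_zero]
  ring

lemma z2'_Nmat_mul (u : ℝ) (g : Matrix (Fin 2) (Fin 2) ℂ) (hw' : w2' g ≠ 0) :
    z2' (Nmat u * g) = z2' g + u := by
  have h := w2'_Nmat_mul u g
  have hd : -g 0 0 + g 1 0 ≠ 0 := fun h0 => hw' (by unfold w2'; linear_combination -h0)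
  have h' : -(Nmat u * g) 0 0 + (Nmat u * g) 1 0 = -g 0 0 + g 1 0 := by
    unfold w2' at h
    linear_combination -h
  unfold z2'
  rw [h', div_add' _ _ _ hd]
  congr 1
  simp only [Nmat, Matrix.mul_apply, Fin.sum_univ_two, of_apply, cons_val', cons_val_zero,
    cons_val_one, cons_val_fin_one]
  field_simp [I_ne_zero]
  ring

lemma phi_Nmat_mul (n r : ℤ) (u : ℝ) (g : Matrix (Fin 2) (Fin 2) ℂ) (hw : w2 g ≠ 0)
    (hw' : w2' g ≠ 0) : phi n r (Nmat u * g) = phi n r g := by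
  simp only [phi, w2_Nmat_mul, w2'_Nmat_mul, z2_Nmat_mul u g hw, z2'_Nmat_mul u g hw',
    add_sub_add_right_eq_sub]

lemma smul_hmat_mul_apply_sub (t l : ℝ) (g : Matrix (Fin 2) (Fin 2) ℂ) (j : Fin 2) :
    -(((l : ℂ) • hmat t) * g) 0 j + (((l : ℂ) • hmat t) * g) 1 j =
      l * Complex.exp (-t) * (-g 0 j + g 1 j) := by
  simp [hmat, Matrix.mul_apply, Fin.sum_univ_two, ← Complex.cosh_sub_sinh]
  ring

lemma smul_hmat_mul_apply_add (t l : ℝ) (g : Matrix (Fin 2) (Fin 2) ℂ) (j : Fin 2) :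
    (((l : ℂ) • hmat t) * g) 0 j + (((l : ℂ) • hmat t) * g) 1 j =
      l * Complex.exp t * (g 0 j + g 1 j) := by
  simp [hmat, Matrix.mul_apply, Fin.sum_univ_two, ← Complex.cosh_add_sinh]
  ring

lemma w2_smul_hmat_mul (t l : ℝ) (g : Matrix (Fin 2) (Fin 2) ℂ) :
    w2 (((l : ℂ) • hmat t) * g) = l * Complex.exp (-t) * w2 g :=
  smul_hmat_mul_apply_sub t l g 1

lemma w2'_smul_hmat_mul (t l : ℝ) (g : Matrix (Fin 2) (Fin 2) ℂ) :
    w2' (((l : ℂ) • hmat t) * g) = l * Complex.exp (-t) * w2' g := by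
  unfold w2'
  linear_combination -smul_hmat_mul_apply_sub t l g 0

lemma mul_exp_div_mul_exp_neg (t l x y : ℂ) (hl : l ≠ 0) :
    I * (l * Complex.exp t * x) / (l * Complex.exp (-t) * y) =
      Complex.exp (2 * t) * (I * x / y) := by
  have h : Complex.exp (2 * t) = Complex.exp t * Complex.exp t := by
    rw [← Complex.exp_add]
    ring_nf
  have ht := Complex.exp_ne_zero t
  rw [h, Complex.exp_neg]
  field_simp

lemma z2_smul_hmat_mul (t l : ℝ) (hl : l ≠ 0) (g : Matrix (Fin 2) (Fin 2) ℂ) :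
    z2 (((l : ℂ) • hmat t) * g) = Complex.exp (2 * t) * z2 g := by
  unfold z2
  rw [smul_hmat_mul_apply_sub, smul_hmat_mul_apply_add,
    mul_exp_div_mul_exp_neg _ _ _ _ (ofReal_ne_zero.2 hl)]

lemma z2'_smul_hmat_mul (t l : ℝ) (hl : l ≠ 0) (g : Matrix (Fin 2) (Fin 2) ℂ) :
    z2' (((l : ℂ) • hmat t) * g) = Complex.exp (2 * t) * z2' g := by
  unfold z2'
  rw [smul_hmat_mul_apply_sub, smul_hmat_mul_apply_add,
    mul_exp_div_mul_exp_neg _ _ _ _ (ofReal_ne_zero.2 hl)]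

lemma phi_smul_hmat_mul (n r : ℤ) (hpar : (2 : ℤ) ∣ (n - r)) (t l : ℝ) (hl : l ≠ 0)
    (g : Matrix (Fin 2) (Fin 2) ℂ) :
    phi n r (((l : ℂ) • hmat t) * g) =
      (Real.exp (((n : ℝ) + 2) * t) : ℂ) * (l : ℂ) ^ (-n) * phi n r g := by
  have hc : (l : ℂ) * Complex.exp (-t) ≠ 0 :=
    mul_ne_zero (ofReal_ne_zero.2 hl) (Complex.exp_ne_zero _)
  have hsum : -((n - r) / 2) + -((n + r) / 2) = -n := by omega
  have hpow : ((l : ℂ) * Complex.exp (-t)) ^ (-((n - r) / 2)) *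
      ((l : ℂ) * Complex.exp (-t)) ^ (-((n + r) / 2)) =
      (l : ℂ) ^ (-n) * Complex.exp (n * t) := by
    rw [← zpow_add₀ hc, hsum, mul_zpow, ← Complex.exp_int_mul]
    push_cast
    ring_nf
  have hexp : ((Real.exp (((n : ℝ) + 2) * t) : ℝ) : ℂ) =
      Complex.exp (2 * t) * Complex.exp (n * t) := by
    rw [← Complex.exp_add]
    push_cast
    ring_nf
  simp only [phi, w2_smul_hmat_mul, w2'_smul_hmat_mul, z2_smul_hmat_mul t l hl,
    z2'_smul_hmat_mul t l hl]
  rw [mul_zpow _ (w2 g), mul_zpow _ (w2' g), hexp]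
  linear_combination Complex.exp (2 * t) * (z2 g - z2' g) * w2 g ^ (-((n - r) / 2)) *
    w2' g ^ (-((n + r) / 2)) * hpow

lemma w2_mul_diag (a d : ℂ) (g : Matrix (Fin 2) (Fin 2) ℂ) :
    w2 (g * !![a, 0; 0, d]) = d * w2 g := by
  simp [w2, Matrix.mul_apply, Fin.sum_univ_two]
  ring

lemma w2'_mul_diag (a d : ℂ) (g : Matrix (Fin 2) (Fin 2) ℂ) :
    w2' (g * !![a, 0; 0, d]) = a * w2' g := by
  simp [w2', Matrix.mul_apply, Fin.sum_univ_two]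
  ring

lemma z2_mul_diag (a d : ℂ) (hd : d ≠ 0) (g : Matrix (Fin 2) (Fin 2) ℂ) :
    z2 (g * !![a, 0; 0, d]) = z2 g := by
  simp only [z2, Matrix.mul_apply, Fin.sum_univ_two, of_apply, cons_val', cons_val_zero,
    cons_val_one, cons_val_fin_one, mul_zero, zero_add]
  rw [← neg_mul, ← add_mul, ← add_mul, ← mul_assoc, mul_div_mul_right _ _ hd]

lemma z2'_mul_diag (a d : ℂ) (ha : a ≠ 0) (g : Matrix (Fin 2) (Fin 2) ℂ) :
    z2' (g * !![a, 0; 0, d]) = z2' g := by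
  simp only [z2', Matrix.mul_apply, Fin.sum_univ_two, of_apply, cons_val', cons_val_zero,
    cons_val_one, cons_val_fin_one, mul_zero, add_zero]
  rw [← neg_mul, ← add_mul, ← add_mul, ← mul_assoc, mul_div_mul_right _ _ ha]

lemma phi_mul_diag (n r : ℤ) (a d : ℂ) (ha : a ≠ 0) (hd : d ≠ 0)
    (g : Matrix (Fin 2) (Fin 2) ℂ) :
    phi n r (g * !![a, 0; 0, d]) =
      a ^ (-((n + r) / 2)) * d ^ (-((n - r) / 2)) * phi n r g := by
  simp only [phi, w2_mul_diag, w2'_mul_diag, z2_mul_diag a d hd, z2'_mul_diag a d ha, mul_zpow]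
  ring

/-- `φ_r^n` lies in the induced representation `Ind_{B₂(ℝ)⁺}^{GL₂(ℝ)⁺} λ(n+2, −n)` and has
weight `λ′(−r, −n)` under the compact torus. -/
theorem stmt_4 (n r : ℤ) (hn : 1 ≤ n) (hpar : (2 : ℤ) ∣ (n - r))
    (g : Matrix (Fin 2) (Fin 2) ℂ) (hw : w2 g ≠ 0) (hw' : w2' g ≠ 0) :
    (∀ u : ℝ, w2 (Nmat u * g) ≠ 0 ∧ w2' (Nmat u * g) ≠ 0 ∧
        phi n r (Nmat u * g) = phi n r g) ∧
    (∀ (t l : ℝ), l ≠ 0 →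
        w2 (((l : ℂ) • hmat t) * g) ≠ 0 ∧ w2' (((l : ℂ) • hmat t) * g) ≠ 0 ∧
        phi n r (((l : ℂ) • hmat t) * g)
          = (Real.exp (((n : ℝ) + 2) * t) : ℂ) * (l : ℂ) ^ (-n) * phi n r g) ∧
    (∀ τ : ℂ, τ ≠ 0 →
        w2 (g * !![τ, 0; 0, (starRingEnd ℂ) τ]) ≠ 0 ∧
        w2' (g * !![τ, 0; 0, (starRingEnd ℂ) τ]) ≠ 0 ∧
        phi n r (g * !![τ, 0; 0, (starRingEnd ℂ) τ])
          = τ ^ (-((n + r) / 2)) * ((starRingEnd ℂ) τ) ^ (-((n - r) / 2)) * phi n r g) := by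
  refine ⟨fun u => ⟨?_, ?_, phi_Nmat_mul n r u g hw hw'⟩,
    fun t l hl => ⟨?_, ?_, phi_smul_hmat_mul n r hpar t l hl g⟩,
    fun τ hτ => ⟨?_, ?_, phi_mul_diag n r _ _ hτ ((map_ne_zero _).2 hτ) g⟩⟩
  · rwa [w2_Nmat_mul]
  · rwa [w2'_Nmat_mul]
  · rw [w2_smul_hmat_mul]
    exact mul_ne_zero (mul_ne_zero (ofReal_ne_zero.2 hl) (Complex.exp_ne_zero _)) hw
  · rw [w2'_smul_hmat_mul]
    exact mul_ne_zero (mul_ne_zero (ofReal_ne_zero.2 hl) (Complex.exp_ne_zero _)) hw'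
  · rw [w2_mul_diag]
    exact mul_ne_zero ((map_ne_zero _).2 hτ) hw
  · rw [w2'_mul_diag]
    exact mul_ne_zero hτ hw'
end

section
/- Let g be a 2×2 complex matrix with w₂(g) ≠ 0 and w₂′(g) ≠ 0, and for s ∈ ℂ set u⁺(s) = [[1, s], [0, 1]] and u⁻(s) = [[1, 0], [s, 1]]. Then the following derivative identities hold at s = 0: (1) the derivative of s ↦ w₂(g·u⁺(s)) is −w₂′(g); (2) the derivative of s ↦ w₂′(g·u⁺(s)) is 0; (3) the derivative of s ↦ z₂(g·u⁺(s)) is 2i·det(g)/w₂(g)²; (4) the derivative of s ↦ z₂′(g·u⁺(s)) is 0; (5) the derivative of s ↦ w₂(g·u⁻(s)) is 0; (6) the derivative of s ↦ w₂′(g·u⁻(s)) is −w₂(g); (7) the derivative of s ↦ z₂(g·u⁻(s)) is 0; (8) the derivative of s ↦ z₂′(g·u⁻(s)) is −2i·det(g)/w₂′(g)². (These are the paper's identities for the action of the root vectors v⁺ and v⁻ on the functions w₂, w₂′, z₂, z₂′.) -/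
open Matrix Complex

/-- The upper-triangular unipotent matrix `u⁺(s)`. -/
noncomputable def uplus (s : ℂ) : Matrix (Fin 2) (Fin 2) ℂ := !![1, s; 0, 1]

/-- The lower-triangular unipotent matrix `u⁻(s)`. -/
noncomputable def uminus (s : ℂ) : Matrix (Fin 2) (Fin 2) ℂ := !![1, 0; s, 1]

theorem hasDerivAt_affine (p q x : ℂ) : HasDerivAt (fun s : ℂ => p * s + q) p x := by
  simpa using ((hasDerivAt_id x).const_mul p).add_const q

/-- The derivative at the origin of a fractional linear map is its determinant divided by the
square of the denominator. -/
theorem hasDerivAt_fractionalLinear_zero (p q r t : ℂ) (ht : t ≠ 0) :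
    HasDerivAt (fun s : ℂ => (p * s + q) / (r * s + t)) ((p * t - q * r) / t ^ 2) 0 := by
  simpa using (hasDerivAt_affine p q 0).fun_div (hasDerivAt_affine r t 0) (by simpa using ht)

/-- The action of the root vectors `v⁺` and `v⁻` on the functions `w₂, w₂′, z₂, z₂′`. -/
theorem stmt_5 (g : Matrix (Fin 2) (Fin 2) ℂ) (hw : w2 g ≠ 0) (hw' : w2' g ≠ 0) :
    HasDerivAt (fun s : ℂ => w2 (g * uplus s)) (-(w2' g)) 0 ∧
    HasDerivAt (fun s : ℂ => w2' (g * uplus s)) 0 0 ∧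
    HasDerivAt (fun s : ℂ => z2 (g * uplus s)) (2 * Complex.I * g.det / (w2 g) ^ 2) 0 ∧
    HasDerivAt (fun s : ℂ => z2' (g * uplus s)) 0 0 ∧
    HasDerivAt (fun s : ℂ => w2 (g * uminus s)) 0 0 ∧
    HasDerivAt (fun s : ℂ => w2' (g * uminus s)) (-(w2 g)) 0 ∧
    HasDerivAt (fun s : ℂ => z2 (g * uminus s)) 0 0 ∧
    HasDerivAt (fun s : ℂ => z2' (g * uminus s))
      (-(2 * Complex.I * g.det / (w2' g) ^ 2)) 0 := by
  have hden : -g 0 1 + g 1 1 ≠ 0 := hw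
  have hden' : -g 0 0 + g 1 0 ≠ 0 := fun h => hw' (by unfold w2'; linear_combination -h)
  have hsq : (g 0 0 - g 1 0) ^ 2 = (-g 0 0 + g 1 0) ^ 2 := by ring
  simp only [w2, w2', z2, z2', uplus, uminus, Matrix.mul_apply, Fin.sum_univ_two, of_apply,
    cons_val', cons_val_zero, cons_val_one, cons_val_fin_one, mul_one, mul_zero, add_zero,
    zero_add, det_fin_two, hsq]
  refine ⟨?_, hasDerivAt_const _ _, ?_, hasDerivAt_const _ _, hasDerivAt_const _ _, ?_,
    hasDerivAt_const _ _, ?_⟩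
  · convert hasDerivAt_affine (g 1 0 - g 0 0) (g 1 1 - g 0 1) 0 using 1
    · ext s; ring
    · ring
  · convert hasDerivAt_fractionalLinear_zero (I * (g 0 0 + g 1 0)) (I * (g 0 1 + g 1 1))
      (-g 0 0 + g 1 0) (-g 0 1 + g 1 1) hden using 1
    · ext s; congr 1 <;> ring
    · congr 1; ring
  · convert hasDerivAt_affine (g 0 1 - g 1 1) (g 0 0 - g 1 0) 0 using 1
    · ext s; ring
    · ring
  · convert hasDerivAt_fractionalLinear_zero (I * (g 0 1 + g 1 1)) (I * (g 0 0 + g 1 0))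
      (-g 0 1 + g 1 1) (-g 0 0 + g 1 0) hden' using 1
    · ext s; congr 1 <;> ring
    · rw [← neg_div]; congr 1; ring
end

section
/- Let n ≥ 1 and r be integers with n ≡ r (mod 2), and let g be a 2×2 complex matrix with w₂(g) ≠ 0 and w₂′(g) ≠ 0. For s ∈ ℂ set u⁺(s) = [[1, s], [0, 1]] and u⁻(s) = [[1, 0], [s, 1]]. Then: (1) the derivative at s = 0 of s ↦ φ_r^n(g·u⁺(s)) equals ((n − r + 2)/2) · φ_{r−2}^n(g); and (2) the derivative at s = 0 of s ↦ φ_r^n(g·u⁻(s)) equals ((n + r + 2)/2) · φ_{r+2}^n(g). (These are the paper's identities v⁺(φ_r^n) = ((n−r+2)/2)·φ_{r−2}^n and v⁻(φ_r^n) = ((n+2+r)/2)·φ_{r+2}^n.) -/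
open Matrix Complex

/-- Where `w₂` and `w₂′` do not vanish, `φ_r^n = 2i · det · w₂^{-(k+1)} · w₂′^{-(l+1)}` with
`n = k + l` and `r = l - k`. -/
lemma phi_eq_det_mul_zpow {n r k l : ℤ} (hk : n - r = 2 * k) (hl : n + r = 2 * l)
    {g : Matrix (Fin 2) (Fin 2) ℂ} (hw : w2 g ≠ 0) (hw' : w2' g ≠ 0) :
    phi n r g = 2 * I * g.det * w2 g ^ (-(k + 1)) * w2' g ^ (-(l + 1)) := by
  have hz : z2 g - z2' g = 2 * I * g.det * (w2 g)⁻¹ * (w2' g)⁻¹ := by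
    have h2 : z2 g = I * (g 0 1 + g 1 1) / w2 g := rfl
    have h2' : z2' g = -(I * (g 0 0 + g 1 0) / w2' g) := by
      rw [z2', w2', ← div_neg]
      ring
    rw [h2, h2', det_fin_two]
    field_simp
    simp only [w2, w2']
    ring
  have hk' : (n - r) / 2 = k := by omega
  have hl' : (n + r) / 2 = l := by omega
  rw [phi, hz, hk', hl', neg_add k, neg_add l, zpow_add₀ hw, zpow_add₀ hw', _root_.zpow_neg_one,
    _root_.zpow_neg_one]
  ring

lemma det_mul_uplus (g : Matrix (Fin 2) (Fin 2) ℂ) (s : ℂ) : (g * uplus s).det = g.det := by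
  simp [uplus, det_mul, det_fin_two_of]

lemma det_mul_uminus (g : Matrix (Fin 2) (Fin 2) ℂ) (s : ℂ) : (g * uminus s).det = g.det := by
  simp [uminus, det_mul, det_fin_two_of]

lemma w2_mul_uplus (g : Matrix (Fin 2) (Fin 2) ℂ) (s : ℂ) :
    w2 (g * uplus s) = w2 g - s * w2' g := by
  simp [w2, w2', uplus, mul_apply, Fin.sum_univ_two]
  ring

lemma w2'_mul_uplus (g : Matrix (Fin 2) (Fin 2) ℂ) (s : ℂ) : w2' (g * uplus s) = w2' g := by
  simp [w2', uplus, mul_apply, Fin.sum_univ_two]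

lemma w2_mul_uminus (g : Matrix (Fin 2) (Fin 2) ℂ) (s : ℂ) : w2 (g * uminus s) = w2 g := by
  simp [w2, uminus, mul_apply, Fin.sum_univ_two]

lemma w2'_mul_uminus (g : Matrix (Fin 2) (Fin 2) ℂ) (s : ℂ) :
    w2' (g * uminus s) = w2' g - s * w2 g := by
  simp [w2, w2', uminus, mul_apply, Fin.sum_univ_two]
  ring

lemma hasDerivAt_sub_mul (a b : ℂ) : HasDerivAt (fun s : ℂ => a - s * b) (-b) 0 := by
  simpa using ((hasDerivAt_id (0 : ℂ)).mul_const b).const_sub a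

lemma eventually_sub_mul_ne_zero {a : ℂ} (ha : a ≠ 0) (b : ℂ) :
    ∀ᶠ s in nhds (0 : ℂ), a - s * b ≠ 0 :=
  (hasDerivAt_sub_mul a b).continuousAt.eventually_ne (by simpa using ha)

lemma hasDerivAt_sub_mul_zpow {a : ℂ} (ha : a ≠ 0) (b : ℂ) (m : ℤ) :
    HasDerivAt (fun s : ℂ => (a - s * b) ^ m) (m * a ^ (m - 1) * -b) 0 := by
  have h := hasDerivAt_zpow m (a - 0 * b) (Or.inl (by simpa using ha))
  simpa [Function.comp_def] using h.comp (0 : ℂ) (hasDerivAt_sub_mul a b)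

/-- `v⁺(φ_r^n) = ((n−r+2)/2)·φ_{r−2}^n` and `v⁻(φ_r^n) = ((n+2+r)/2)·φ_{r+2}^n`. -/
theorem stmt_6 (n r : ℤ) (hn : 1 ≤ n) (hpar : (2 : ℤ) ∣ (n - r))
    (g : Matrix (Fin 2) (Fin 2) ℂ) (hw : w2 g ≠ 0) (hw' : w2' g ≠ 0) :
    HasDerivAt (fun s : ℂ => phi n r (g * uplus s))
      ((((n : ℂ) - (r : ℂ) + 2) / 2) * phi n (r - 2) g) 0 ∧
    HasDerivAt (fun s : ℂ => phi n r (g * uminus s))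
      ((((n : ℂ) + (r : ℂ) + 2) / 2) * phi n (r + 2) g) 0 := by
  obtain ⟨k, hk⟩ := hpar
  obtain ⟨l, hl⟩ : ∃ l, n + r = 2 * l := ⟨k + r, by omega⟩
  have hkC : (n : ℂ) - r = 2 * k := by exact_mod_cast hk
  have hlC : (n : ℂ) + r = 2 * l := by exact_mod_cast hl
  constructor
  · rw [phi_eq_det_mul_zpow (k := k + 1) (l := l - 1) (by omega) (by omega) hw hw', hkC]
    have h := ((hasDerivAt_sub_mul_zpow hw (w2' g) (-(k + 1))).const_mul
      (2 * I * g.det)).mul_const (w2' g ^ (-(l + 1)))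
    refine (h.congr_of_eventuallyEq ?_).congr_deriv ?_
    · filter_upwards [eventually_sub_mul_ne_zero hw (w2' g)] with s hs
      rw [phi_eq_det_mul_zpow hk hl (by rwa [w2_mul_uplus]) (by rwa [w2'_mul_uplus]),
        det_mul_uplus, w2_mul_uplus, w2'_mul_uplus]
    · rw [show -(l - 1 + 1) = -(l + 1) + 1 by ring, zpow_add_one₀ hw',
        show -(k + 1 + 1) = -(k + 1) - 1 by ring]
      push_cast
      ring
  · rw [phi_eq_det_mul_zpow (k := k - 1) (l := l + 1) (by omega) (by omega) hw hw', hlC]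
    have h := (hasDerivAt_sub_mul_zpow hw' (w2 g) (-(l + 1))).const_mul
      (2 * I * g.det * w2 g ^ (-(k + 1)))
    refine (h.congr_of_eventuallyEq ?_).congr_deriv ?_
    · filter_upwards [eventually_sub_mul_ne_zero hw' (w2 g)] with s hs
      rw [phi_eq_det_mul_zpow hk hl (by rwa [w2_mul_uminus]) (by rwa [w2'_mul_uminus]),
        det_mul_uminus, w2_mul_uminus, w2'_mul_uminus]
    · rw [show -(k - 1 + 1) = -(k + 1) + 1 by ring, zpow_add_one₀ hw,
        show -(l + 1 + 1) = -(l + 1) - 1 by ring]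
      push_cast
      ring
end

section
/- Let n ≥ 1 and r be integers with n ≡ r (mod 2), and let g be a 2×2 complex matrix satisfying the reality condition conj(g₁₁) = g₂₂ and conj(g₁₂) = g₂₁ (i.e. g lies in the real form GU(J₂′)′(ℝ)), with w₂(g) ≠ 0 and w₂′(g) ≠ 0. Then conj(φ_r^n(g)) = −φ_{−r}^n(g), where conj denotes complex conjugation on ℂ. (This is the paper's complex-conjugation identity for the functions φ_r^n, which underlies the relation between the holomorphic and antiholomorphic Eisenstein forms ω_n^± in the Deligne–Beilinson representative of the Eisenstein symbol.) -/
open Matrix Complex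

theorem conj_w2 {g : Matrix (Fin 2) (Fin 2) ℂ}
    (h₁ : (starRingEnd ℂ) (g 0 0) = g 1 1) (h₂ : (starRingEnd ℂ) (g 0 1) = g 1 0) :
    (starRingEnd ℂ) (w2 g) = w2' g := by
  simp only [w2, w2', map_add, map_neg, ← h₁, h₂, Complex.conj_conj]
  ring

theorem conj_z2 {g : Matrix (Fin 2) (Fin 2) ℂ}
    (h₁ : (starRingEnd ℂ) (g 0 0) = g 1 1) (h₂ : (starRingEnd ℂ) (g 0 1) = g 1 0) :
    (starRingEnd ℂ) (z2 g) = z2' g := by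
  simp only [z2, z2', map_div₀, map_mul, map_add, map_neg, ← h₁, h₂, Complex.conj_conj,
    Complex.conj_I]
  rw [← neg_div_neg_eq]
  congr 1 <;> ring

/-- The complex-conjugation identity `conj(φ_r^n(g)) = −φ_{−r}^n(g)` for `g` in the real form
`GU(J₂′)′(ℝ)`. -/
theorem stmt_7 (n r : ℤ) (hn : 1 ≤ n) (hpar : (2 : ℤ) ∣ (n - r))
    (g : Matrix (Fin 2) (Fin 2) ℂ)
    (hreal1 : (starRingEnd ℂ) (g 0 0) = g 1 1)
    (hreal2 : (starRingEnd ℂ) (g 0 1) = g 1 0)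
    (hw : w2 g ≠ 0) (hw' : w2' g ≠ 0) :
    (starRingEnd ℂ) (phi n r g) = -(phi n (-r) g) := by
  have h_w := conj_w2 hreal1 hreal2
  have h_z := conj_z2 hreal1 hreal2
  have h_w' : (starRingEnd ℂ) (w2' g) = w2 g := by rw [← h_w, Complex.conj_conj]
  have h_z' : (starRingEnd ℂ) (z2' g) = z2 g := by rw [← h_z, Complex.conj_conj]
  simp only [phi, map_mul, map_sub, map_zpow₀, h_w, h_w', h_z, h_z', sub_neg_eq_add,
    ← sub_eq_add_neg]
  ring
end

section
/- Let R be a commutative ring, L a Lie algebra over R, and M, N Lie modules over L. Let x ∈ L, v ∈ M, w ∈ N, and let p ≤ q be natural numbers such that x^{p+1} • v = 0 in M and x^{q+1} • w = 0 in N, where x^j • denotes the j-fold iterated Lie action of x. Then in the Lie module M ⊗_R N (with action x • (m ⊗ n) = (x • m) ⊗ n + m ⊗ (x • n)) one has ⁅x, Σ_{i=0}^{p} (−1)^i · (x^i • v) ⊗ (x^{q−i} • w)⁆ = 0. (This is the key computation in the paper's Proposition 6.2: the vector Σ_{i=0}^{a+b} (−1)^i X_{(1,−1,0)}^i v ⊗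 X_{(1,−1,0)}^{2+a+b−i} Ψ_∞ is annihilated by X_{(1,−1,0)} and hence is a highest weight vector of the K-type τ_{(1,−1,0)}, which produces the differential form ω.) -/
open TensorProduct

/-- The action of `x` on an alternating sum of tensors `(x^i • v) ⊗ (x^{q-i} • w)` telescopes. -/
theorem lie_sum_neg_one_pow_smul_tmul_iterate {R L M N : Type*} [CommRing R] [LieRing L]
    [LieAlgebra R L] [AddCommGroup M] [Module R M] [LieRingModule L M] [LieModule R L M]
    [AddCommGroup N] [Module R N] [LieRingModule L N] [LieModule R L N]
    (x : L) (v : M) (w : N) {k q : ℕ} (hk : k ≤ q + 1) :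
    ⁅x, ∑ i ∈ Finset.range k,
        ((-1 : ℤ) ^ i) • ((fun m : M => ⁅x, m⁆)^[i] v ⊗ₜ[R] (fun n : N => ⁅x, n⁆)^[q - i] w)⁆
      = v ⊗ₜ[R] (fun n : N => ⁅x, n⁆)^[q + 1] w
        - ((-1 : ℤ) ^ k) •
          ((fun m : M => ⁅x, m⁆)^[k] v ⊗ₜ[R] (fun n : N => ⁅x, n⁆)^[q + 1 - k] w) := by
  induction k with
  | zero => simp
  | succ k ih =>
    have hq : q + 1 - k = (q - k) + 1 := by omega
    rw [Finset.sum_range_succ, lie_add, ih (by omega), lie_zsmul,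
      TensorProduct.LieModule.lie_tmul_right, hq, Nat.add_sub_add_right,
      Function.iterate_succ_apply' _ k v, Function.iterate_succ_apply' _ (q - k) w, pow_succ]
    module

/-- If `x^{p+1} • v = 0` and `x^{q+1} • w = 0` for Lie-module elements `v`, `w`, then the vector
`Σ_{i=0}^{p} (−1)^i (x^i • v) ⊗ (x^{q−i} • w)` in `M ⊗[R] N` is annihilated by `x`.
This is the key computation producing the highest weight vector of the K-type `τ_{(1,−1,0)}`
in the paper's construction of the differential form `ω`. -/
theorem stmt_9 (R : Type*) [CommRing R] (L : Type*) [LieRing L] [LieAlgebra R L]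
    (M : Type*) [AddCommGroup M] [Module R M] [LieRingModule L M] [LieModule R L M]
    (N : Type*) [AddCommGroup N] [Module R N] [LieRingModule L N] [LieModule R L N]
    (x : L) (v : M) (w : N) (p q : ℕ) (hpq : p ≤ q)
    (hv : (fun m : M => ⁅x, m⁆)^[p + 1] v = 0)
    (hw : (fun n : N => ⁅x, n⁆)^[q + 1] w = 0) :
    ⁅x, ∑ i ∈ Finset.range (p + 1),
        ((-1 : ℤ) ^ i) • ((fun m : M => ⁅x, m⁆)^[i] v ⊗ₜ[R] (fun n : N => ⁅x, n⁆)^[q - i] w)⁆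
      = (0 : M ⊗[R] N) := by
  rw [lie_sum_neg_one_pow_smul_tmul_iterate x v w (by omega), hv, hw]
  simp
end

section
/- Let R be a commutative ring, M and N R-modules, F_M an R-linear endomorphism of M, F_N an R-linear endomorphism of N, P a natural number, and m : ℕ → M, u : ℕ → N families of vectors satisfying: F_M(m 0) = 0; F_M(m i) = (i·(P + 1 − i)) • m(i − 1) for all 1 ≤ i ≤ P; and F_N(u j) = (j·(P + 3 − j)) • u(j − 1) for all 1 ≤ j ≤ P + 2 (natural-number scalars acting by repeated addition). Then, applying the operator F_M ⊗ id + id ⊗ F_N on M ⊗_R N, one has (F_M ⊗ id + id ⊗ F_N)( Σ_{i=0}^{P} (−1)^i · m(i) ⊗ u(P + 2 − i) ) = 2 · Σ_{i=0}^{P} (−1)^i · (i + 1) · m(i) ⊗ u(P + 1 − i). (This is the computation behind the paper's Proposition on the pullback of the differential form: ι*ω(v⁺ ⊗ v⁻) = −Σ_{i=0}^{a+b} (−1)^i (i+1) X^i v ⊗ X^{1+a+b−i} Ψ_∞, obtained by applying the lowering operator −(1/2)·X_{(−1,1,0)} diagonally, with P = a + b.) -/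
open TensorProduct

/-- The computation behind the pullback of the differential form: applying the lowering
operator `F_M ⊗ id + id ⊗ F_N` to `Σ_{i=0}^{P} (−1)^i m(i) ⊗ u(P+2−i)` yields
`2 · Σ_{i=0}^{P} (−1)^i (i+1) m(i) ⊗ u(P+1−i)`. -/
theorem stmt_10 (R : Type*) [CommRing R]
    (M : Type*) [AddCommGroup M] [Module R M]
    (N : Type*) [AddCommGroup N] [Module R N]
    (FM : M →ₗ[R] M) (FN : N →ₗ[R] N) (P : ℕ) (m : ℕ → M) (u : ℕ → N)
    (hM0 : FM (m 0) = 0)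
    (hM : ∀ i, 1 ≤ i → i ≤ P → FM (m i) = (i * (P + 1 - i)) • m (i - 1))
    (hN : ∀ j, 1 ≤ j → j ≤ P + 2 → FN (u j) = (j * (P + 3 - j)) • u (j - 1)) :
    (TensorProduct.map FM (LinearMap.id : N →ₗ[R] N)
        + TensorProduct.map (LinearMap.id : M →ₗ[R] M) FN)
      (∑ i ∈ Finset.range (P + 1), ((-1 : ℤ) ^ i) • (m i ⊗ₜ[R] u (P + 2 - i)))
    = (2 : ℤ) • ∑ i ∈ Finset.range (P + 1),
        ((-1 : ℤ) ^ i * ((i : ℤ) + 1)) • (m i ⊗ₜ[R] u (P + 1 - i)) := by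
  have hL : ∑ i ∈ Finset.range (P + 1), ((-1 : ℤ) ^ i) • (FM (m i) ⊗ₜ[R] u (P + 2 - i))
      = ∑ i ∈ Finset.range (P + 1),
        ((-1 : ℤ) ^ (i + 1) * (((i : ℤ) + 1) * ((P : ℤ) - i))) •
          (m i ⊗ₜ[R] u (P + 1 - i)) := by
    rw [Finset.sum_range_succ', Finset.sum_range_succ]
    simp only [hM0, TensorProduct.zero_tmul, smul_zero, sub_self, mul_zero, zero_smul, add_zero]
    refine Finset.sum_congr rfl fun i hi => ?_
    have hi' : i < P := Finset.mem_range.mp hi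
    rw [hM (i + 1) (by omega) (by omega), TensorProduct.smul_tmul', ← natCast_zsmul, smul_smul,
      Nat.add_sub_cancel, show P + 2 - (i + 1) = P + 1 - i by omega,
      show P + 1 - (i + 1) = P - i by omega]
    push_cast [Nat.cast_sub hi'.le]
    rfl
  have hR : ∑ i ∈ Finset.range (P + 1), ((-1 : ℤ) ^ i) • (m i ⊗ₜ[R] FN (u (P + 2 - i)))
      = ∑ i ∈ Finset.range (P + 1),
        ((-1 : ℤ) ^ i * (((P : ℤ) + 2 - i) * ((i : ℤ) + 1))) •
          (m i ⊗ₜ[R] u (P + 1 - i)) := by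
    refine Finset.sum_congr rfl fun i hi => ?_
    have hi' : i < P + 1 := Finset.mem_range.mp hi
    rw [hN (P + 2 - i) (by omega) (by omega), TensorProduct.tmul_smul, ← natCast_zsmul, smul_smul,
      show P + 2 - i - 1 = P + 1 - i by omega, show P + 3 - (P + 2 - i) = i + 1 by omega]
    push_cast [Nat.cast_sub (show i ≤ P + 2 by omega)]
    rfl
  simp only [LinearMap.add_apply, map_sum, map_zsmul, TensorProduct.map_tmul, LinearMap.id_apply,
    smul_add, Finset.sum_add_distrib]
  rw [hL, hR, ← Finset.sum_add_distrib, Finset.smul_sum]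
  refine Finset.sum_congr rfl fun i _ => ?_
  rw [← add_smul, smul_smul]
  congr 1
  ring
end

section
/- Let n be a natural number and k an integer with |k| ≤ n and n ≡ k (mod 2), and let Φ∞ : ℝ² → ℂ be defined by Φ∞(x, y) = (ix − y)^{(n−k)/2}·(ix + y)^{(n+k)/2}·exp(−π(x² + y²)). Let g = [[a, b], [c, d]] be a real 2×2 matrix with det g ≠ 0 (so (c, d) ≠ (0, 0)), and let z ∈ ℂ with Re z > 0. Then the function t ↦ Φ∞(ct, dt) · sgn(t)^n · |t|^{2z−n} / |t| is integrable on ℝ ∖ {0}, and ∫_{ℝ∖{0}} Φ∞(ct, dt) · sgn(t)^n · |t|^{2z−n} · dt/|t| = (ic − d)^{(n−k)/2} · (ic + d)^{(n+k)/2} · π^{−z} · (c² + d²)^{−z} · Γ(z). Consequently the archimedean section satisfies f(g, Φ∞, ν∞, z) := sgn(det g)^n · |det g|^{z−n} · ∫_{ℝ∖{0}} Φ∞(ct, dt) · sgn(t)^n · |t|^{2z−n} · dt/|t| = sgn(det g)^n · |det g|^{z−n} · (ic − d)^{(n−k)/2} · (ic + d)^{(n+k)/2} · π^{−z} · (c²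 + d²)^{−z} · Γ(z). (This is the paper's Lemma giving the explicit archimedean value of the Godement–Siegel section, whose core is the Gaussian Mellin transform 2∫₀^∞ e^{−π(c²+d²)t²} t^{2z} dt/t = (π(c² + d²))^{−z} Γ(z).) -/
open Matrix Complex MeasureTheory

/-- The archimedean Schwartz function
`Φ∞(x, y) = (ix − y)^{(n−k)/2} · (ix + y)^{(n+k)/2} · e^{−π(x²+y²)}`. -/
noncomputable def PhiInf (n : ℕ) (k : ℤ) (x y : ℝ) : ℂ :=
  ((Complex.I * (x : ℂ) - (y : ℂ)) ^ (((n : ℤ) - k) / 2)) *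
    ((Complex.I * (x : ℂ) + (y : ℂ)) ^ (((n : ℤ) + k) / 2)) *
    Complex.exp (-(((Real.pi * (x ^ 2 + y ^ 2) : ℝ)) : ℂ))

theorem MeasureTheory.IntegrableOn.integrable_comp_abs {E : Type*} [NormedAddCommGroup E]
    {f : ℝ → E} (hf : IntegrableOn f (Set.Ioi 0)) : Integrable fun t : ℝ => f |t| := by
  have hpos : IntegrableOn (fun t : ℝ => f |t|) (Set.Ioi 0) :=
    hf.congr_fun (fun t ht => by simp only [abs_of_pos (Set.mem_Ioi.1 ht)]) measurableSet_Ioi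
  have hneg : IntegrableOn (fun t : ℝ => f |t|) (Set.Iio 0) := by
    rw [← (Measure.measurePreserving_neg (volume : Measure ℝ)).integrableOn_comp_preimage
      (Homeomorph.neg ℝ).measurableEmbedding]
    simpa [Function.comp_def] using hpos
  rw [← integrableOn_univ, ← Set.Iio_union_Ici (a := (0 : ℝ)), integrableOn_union,
    integrableOn_Ici_iff_integrableOn_Ioi]
  exact ⟨hneg, hpos⟩

theorem integral_comp_abs_of_integrableOn {E : Type*} [NormedAddCommGroup E] [NormedSpace ℝ E]
    {f : ℝ → E} (hf : IntegrableOn f (Set.Ioi 0)) :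
    ∫ t : ℝ, f |t| = (2 : ℝ) • ∫ t in Set.Ioi (0 : ℝ), f t := by
  have hpos : ∫ t in Set.Ioi (0 : ℝ), f |t| = ∫ t in Set.Ioi (0 : ℝ), f t :=
    setIntegral_congr_fun measurableSet_Ioi fun t ht => by
      simp only [abs_of_pos (Set.mem_Ioi.1 ht)]
  have hneg : ∫ t in Set.Iic (0 : ℝ), f |t| = ∫ t in Set.Ioi (0 : ℝ), f |t| := by
    simpa using integral_comp_neg_Iic 0 fun t : ℝ => f |t|
  have hint := hf.integrable_comp_abs
  rw [← setIntegral_univ, ← Set.Iic_union_Ioi (a := (0 : ℝ)),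
    setIntegral_union (Set.Iic_disjoint_Ioi le_rfl) measurableSet_Ioi hint.integrableOn
      hint.integrableOn, hneg, hpos, two_smul]

theorem hasMellin_cexp_neg_mul {r : ℝ} (hr : 0 < r) {s : ℂ} (hs : 0 < s.re) :
    HasMellin (fun t : ℝ => cexp (-(r * t))) s ((r : ℂ) ^ (-s) * Complex.Gamma s) := by
  constructor
  · have h : MellinConvergent (fun t : ℝ => cexp (-t)) s :=
      (Complex.GammaIntegral_convergent hs).congr_fun
        (fun t _ => by simp [mul_comm]) measurableSet_Ioi
    simpa using (MellinConvergent.comp_mul_left hr).2 h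
  · have harg : (r : ℂ).arg ≠ Real.pi := by
      rw [Complex.arg_ofReal_of_nonneg hr.le]
      exact Real.pi_pos.ne
    simp only [mellin, smul_eq_mul]
    rw [integral_cpow_mul_exp_neg_mul_Ioi hs hr, one_div, inv_cpow _ _ harg, cpow_neg]

theorem hasMellin_cexp_neg_mul_sq {r : ℝ} (hr : 0 < r) {s : ℂ} (hs : 0 < s.re) :
    HasMellin (fun t : ℝ => cexp (-(r * t ^ 2))) (2 * s)
      ((r : ℂ) ^ (-s) * Complex.Gamma s / 2) := by
  have hdiv : 2 * s / ((2 : ℝ) : ℂ) = s := by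
    push_cast
    exact mul_div_cancel_left₀ s two_ne_zero
  have h := hasMellin_cexp_neg_mul hr hs
  constructor
  · have := (MellinConvergent.comp_rpow (f := fun t : ℝ => cexp (-(r * t))) (s := 2 * s)
      (two_ne_zero (α := ℝ))).2 (by rw [hdiv]; exact h.1)
    simpa using this
  · have := mellin_comp_rpow (fun t : ℝ => cexp (-(r * t))) (2 * s) 2
    rw [hdiv, h.2] at this
    simp only [Real.rpow_two, ofReal_pow] at this
    rw [this, abs_of_pos two_pos, Complex.real_smul]
    push_cast
    ring

theorem PhiInf_mul {n : ℕ} {k : ℤ} (hpar : (2 : ℤ) ∣ (n : ℤ) - k) (c d : ℝ) {t : ℝ}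
    (ht : t ≠ 0) :
    PhiInf n k (c * t) (d * t) =
      (I * c - d) ^ (((n : ℤ) - k) / 2) * (I * c + d) ^ (((n : ℤ) + k) / 2) * (t : ℂ) ^ n *
        cexp (-((Real.pi * (c ^ 2 + d ^ 2) : ℝ) * (t : ℂ) ^ 2)) := by
  have ht' : (t : ℂ) ≠ 0 := ofReal_ne_zero.2 ht
  have hsum : ((n : ℤ) - k) / 2 + ((n : ℤ) + k) / 2 = n := by omega
  have hpow : (t : ℂ) ^ (((n : ℤ) - k) / 2) * (t : ℂ) ^ (((n : ℤ) + k) / 2) = (t : ℂ) ^ n := by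
    rw [← zpow_add₀ ht', hsum, zpow_natCast]
  have hsub : I * ((c * t : ℝ) : ℂ) - ((d * t : ℝ) : ℂ) = (I * c - d) * t := by
    push_cast
    ring
  have hadd : I * ((c * t : ℝ) : ℂ) + ((d * t : ℝ) : ℂ) = (I * c + d) * t := by
    push_cast
    ring
  have hexp : (((Real.pi * ((c * t) ^ 2 + (d * t) ^ 2) : ℝ)) : ℂ) =
      (Real.pi * (c ^ 2 + d ^ 2) : ℝ) * (t : ℂ) ^ 2 := by
    push_cast
    ring
  rw [PhiInf, hsub, hadd, hexp, mul_zpow, mul_zpow, ← hpow]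
  ring

theorem ofReal_pow_mul_sign_pow (t : ℝ) (n : ℕ) :
    (t : ℂ) ^ n * (Real.sign t : ℂ) ^ n = ((|t| : ℝ) : ℂ) ^ n := by
  rw [← mul_pow, ← ofReal_mul]
  congr 2
  rcases lt_trichotomy t 0 with h | rfl | h
  · rw [Real.sign_of_neg h, abs_of_neg h, mul_neg_one]
  · simp
  · rw [Real.sign_of_pos h, abs_of_pos h, mul_one]

theorem PhiInf_mul_sign_mul_cpow {n : ℕ} {k : ℤ} (hpar : (2 : ℤ) ∣ (n : ℤ) - k) (c d : ℝ)
    (z : ℂ) {t : ℝ} (ht : t ≠ 0) :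
    PhiInf n k (c * t) (d * t) * ((Real.sign t : ℝ) : ℂ) ^ n *
        ((|t| : ℝ) : ℂ) ^ (2 * z - (n : ℂ)) / ((|t| : ℝ) : ℂ) =
      (I * c - d) ^ (((n : ℤ) - k) / 2) * (I * c + d) ^ (((n : ℤ) + k) / 2) *
        (((|t| : ℝ) : ℂ) ^ (2 * z - 1) *
          cexp (-((Real.pi * (c ^ 2 + d ^ 2) : ℝ) * ((|t| : ℝ) : ℂ) ^ 2))) := by
  have habs : ((|t| : ℝ) : ℂ) ≠ 0 := ofReal_ne_zero.2 (abs_ne_zero.2 ht)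
  have hsq : ((|t| : ℝ) : ℂ) ^ 2 = (t : ℂ) ^ 2 := by
    rw [← ofReal_pow, sq_abs, ofReal_pow]
  have hcpow : ((|t| : ℝ) : ℂ) ^ (2 * z - 1) =
      (t : ℂ) ^ n * (Real.sign t : ℂ) ^ n * ((|t| : ℝ) : ℂ) ^ (2 * z - (n : ℂ)) /
        ((|t| : ℝ) : ℂ) := by
    rw [ofReal_pow_mul_sign_pow, ← cpow_natCast, ← cpow_add _ _ habs, add_sub_cancel,
      cpow_sub _ _ habs, cpow_one]
  rw [PhiInf_mul hpar c d ht, hsq, hcpow]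
  ring

/-- Explicit evaluation of the archimedean Godement–Siegel section: for `g` invertible with
second row `(c, d)` and `Re z > 0`, the Tate-type integral defining `f(g, Φ∞, ν∞, z)`
converges and equals `(ic − d)^{(n−k)/2}(ic + d)^{(n+k)/2} π^{−z} (c² + d²)^{−z} Γ(z)`,
up to the elementary prefactor `sgn(det g)^n |det g|^{z−n}`. -/
theorem stmt_12 (n : ℕ) (k : ℤ) (hk : |k| ≤ (n : ℤ)) (hpar : (2 : ℤ) ∣ ((n : ℤ) - k))
    (g : Matrix (Fin 2) (Fin 2) ℝ) (hg : g.det ≠ 0) (z : ℂ) (hz : 0 < z.re) :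
    IntegrableOn
      (fun t : ℝ => PhiInf n k (g 1 0 * t) (g 1 1 * t) * ((Real.sign t : ℝ) : ℂ) ^ n *
        ((|t| : ℝ) : ℂ) ^ (2 * z - (n : ℂ)) / ((|t| : ℝ) : ℂ)) ({(0 : ℝ)}ᶜ) ∧
    (∫ t in ({(0 : ℝ)}ᶜ : Set ℝ),
        PhiInf n k (g 1 0 * t) (g 1 1 * t) * ((Real.sign t : ℝ) : ℂ) ^ n *
          ((|t| : ℝ) : ℂ) ^ (2 * z - (n : ℂ)) / ((|t| : ℝ) : ℂ))
      = (Complex.I * ((g 1 0 : ℝ) : ℂ) - ((g 1 1 : ℝ) : ℂ)) ^ (((n : ℤ) - k) / 2) *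
          (Complex.I * ((g 1 0 : ℝ) : ℂ) + ((g 1 1 : ℝ) : ℂ)) ^ (((n : ℤ) + k) / 2) *
          ((Real.pi : ℝ) : ℂ) ^ (-z) * ((g 1 0 ^ 2 + g 1 1 ^ 2 : ℝ) : ℂ) ^ (-z) *
          Complex.Gamma z ∧
    ((Real.sign g.det : ℝ) : ℂ) ^ n * ((|g.det| : ℝ) : ℂ) ^ (z - (n : ℂ)) *
        (∫ t in ({(0 : ℝ)}ᶜ : Set ℝ),
          PhiInf n k (g 1 0 * t) (g 1 1 * t) * ((Real.sign t : ℝ) : ℂ) ^ n *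
            ((|t| : ℝ) : ℂ) ^ (2 * z - (n : ℂ)) / ((|t| : ℝ) : ℂ))
      = ((Real.sign g.det : ℝ) : ℂ) ^ n * ((|g.det| : ℝ) : ℂ) ^ (z - (n : ℂ)) *
          ((Complex.I * ((g 1 0 : ℝ) : ℂ) - ((g 1 1 : ℝ) : ℂ)) ^ (((n : ℤ) - k) / 2) *
            (Complex.I * ((g 1 0 : ℝ) : ℂ) + ((g 1 1 : ℝ) : ℂ)) ^ (((n : ℤ) + k) / 2) *
            ((Real.pi : ℝ) : ℂ) ^ (-z) * ((g 1 0 ^ 2 + g 1 1 ^ 2 : ℝ) : ℂ) ^ (-z) *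
            Complex.Gamma z) := by
  have hr : 0 < g 1 0 ^ 2 + g 1 1 ^ 2 := by
    by_contra! h
    have hc : g 1 0 = 0 := by nlinarith [sq_nonneg (g 1 0), sq_nonneg (g 1 1)]
    have hd : g 1 1 = 0 := by nlinarith [sq_nonneg (g 1 0), sq_nonneg (g 1 1)]
    exact hg (by rw [Matrix.det_fin_two, hc, hd]; ring)
  have hmeas : MeasurableSet ({(0 : ℝ)}ᶜ : Set ℝ) := (measurableSet_singleton 0).compl
  obtain ⟨hconv, hval⟩ := hasMellin_cexp_neg_mul_sq (mul_pos Real.pi_pos hr) hz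
  have hcongr : Set.EqOn _ _ ({(0 : ℝ)}ᶜ : Set ℝ) := fun t ht =>
    PhiInf_mul_sign_mul_cpow hpar (g 1 0) (g 1 1) z ht
  have hint := IntegrableOn.integrable_comp_abs hconv
  have heq := integral_comp_abs_of_integrableOn hconv
  simp only [mellin] at hval
  rw [hval] at heq
  simp only [smul_eq_mul] at hint heq
  have hpi : ((Real.pi * (g 1 0 ^ 2 + g 1 1 ^ 2) : ℝ) : ℂ) ^ (-z) =
      (Real.pi : ℂ) ^ (-z) * ((g 1 0 ^ 2 + g 1 1 ^ 2 : ℝ) : ℂ) ^ (-z) := by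
    rw [ofReal_mul, mul_cpow_ofReal_nonneg Real.pi_pos.le hr.le]
  refine (fun h => ⟨h.1, h.2, congrArg _ h.2⟩ : _ ∧ _ → _) ⟨?_, ?_⟩
  · exact (integrableOn_congr_fun hcongr hmeas).2 (hint.const_mul _).integrableOn
  · rw [setIntegral_congr_fun hmeas hcongr, restrict_compl_singleton,
      integral_const_mul, heq, hpi, Complex.real_smul]
    push_cast
    ring
end

section
/- Let n be a natural number, let Φ : ℝ² → ℂ be a Schwartz function, and let s ∈ ℂ with Re s > n/2. For an invertible real 2×2 matrix g, define f(g, Φ, s) = sgn(det g)^n · |det g|^{s−n} · ∫_{ℝ∖{0}} Φ(t·g₂₁, t·g₂₂) · sgn(t)^n · |t|^{2s−n} · dt/|t|, where complex powers of positive reals are principal. Then for every invertible real g this integral converges absolutely, and for all nonzero real numbers α, δ, every real β, and b = [[α, β], [0, δ]], one has f(b·g, Φ, s) = sgn(α)^n · |α|^{−n} · (|α|/|δ|)^{s} · f(g, Φ, s). (This is the archimedean case of the paper's Proposition that g ↦ f(g, Φ, ν, s) belongs to the induced representation Ind_{B₂}^{GL₂} χ_{ν₁,ν₂,s}, for ν₁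 = |·|^{−n}·sgn(·)^n and ν₂ = 1.) -/
open Matrix Complex MeasureTheory

/-- The archimedean section `f(g, Φ, s) = sgn(det g)^n |det g|^{s−n}
∫_{ℝ∖{0}} Φ(t·g₂₁, t·g₂₂) sgn(t)^n |t|^{2s−n} dt/|t|`. -/
noncomputable def fsec (n : ℕ) (Φ : SchwartzMap (ℝ × ℝ) ℂ) (s : ℂ)
    (g : Matrix (Fin 2) (Fin 2) ℝ) : ℂ :=
  ((Real.sign g.det : ℝ) : ℂ) ^ n * ((|g.det| : ℝ) : ℂ) ^ (s - (n : ℂ)) *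
    ∫ t in ({(0 : ℝ)}ᶜ : Set ℝ),
      Φ (t * g 1 0, t * g 1 1) * ((Real.sign t : ℝ) : ℂ) ^ n *
        ((|t| : ℝ) : ℂ) ^ (2 * s - (n : ℂ)) / ((|t| : ℝ) : ℂ)

/-- A Schwartz function restricted to a punctured line through the origin has a convergent Mellin
transform on the right half-plane. -/
theorem mellinConvergent_schwartzMap_smul {E : Type*} [NormedAddCommGroup E] [NormedSpace ℝ E]
    (Φ : SchwartzMap E ℂ) {v : E} (hv : v ≠ 0) {w : ℂ} (hw : 0 < w.re) :
    MellinConvergent (fun t : ℝ => Φ (t • v)) w := by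
  have hcont : Continuous fun t : ℝ => Φ (t • v) :=
    Φ.continuous.comp (continuous_id.smul continuous_const)
  obtain ⟨k, hk⟩ := exists_nat_gt w.re
  obtain ⟨C, -, hC⟩ := Φ.decay k 0
  refine mellinConvergent_of_isBigO_rpow (a := k) (b := 0)
    (hcont.locallyIntegrable.locallyIntegrableOn _) ?_ hk ?_ hw
  · refine Asymptotics.IsBigO.of_bound (C / ‖v‖ ^ k) ?_
    filter_upwards [Filter.eventually_gt_atTop 0] with t ht
    have hvk : 0 < ‖v‖ ^ k := pow_pos (norm_pos_iff.2 hv) k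
    have h := hC (t • v)
    rw [norm_iteratedFDeriv_zero, norm_smul, mul_pow, Real.norm_of_nonneg ht.le] at h
    rw [Real.rpow_neg ht.le, Real.rpow_natCast, Real.norm_of_nonneg (by positivity),
      ← div_eq_mul_inv, div_div, le_div_iff₀ (by positivity)]
    linarith
  · simp only [neg_zero, Real.rpow_zero]
    exact (hcont.tendsto 0).isBigO_one ℝ |>.mono nhdsWithin_le_nhds

theorem Real.sign_mul (a b : ℝ) : Real.sign (a * b) = Real.sign a * Real.sign b := by
  rcases lt_trichotomy a 0 with ha | rfl | ha <;> rcases lt_trichotomy b 0 with hb | rfl | hb <;>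
    simp [Real.sign_of_pos, Real.sign_of_neg, mul_pos_of_neg_of_neg,
      mul_neg_of_pos_of_neg, mul_neg_of_neg_of_pos, *]

/-- Multiplication by `sgn(t)^n |t|^{w-1}` makes a Schwartz function on a line through the origin
integrable when `Re w > 0`. -/
theorem integrableOn_schwartzMap_sign_pow_mul_cpow (n : ℕ) (Φ : SchwartzMap (ℝ × ℝ) ℂ)
    {x y : ℝ} (hxy : (x, y) ≠ (0 : ℝ × ℝ)) {w : ℂ} (hw : 0 < w.re) :
    IntegrableOn
      (fun t : ℝ => Φ (t * x, t * y) * ((Real.sign t : ℝ) : ℂ) ^ n *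
        ((|t| : ℝ) : ℂ) ^ w / ((|t| : ℝ) : ℂ)) ({(0 : ℝ)}ᶜ) := by
  have hpos := mellinConvergent_schwartzMap_smul Φ hxy hw
  have hneg := mellinConvergent_schwartzMap_smul Φ (neg_ne_zero.2 hxy) hw
  rw [← Set.Iio_union_Ioi]
  refine IntegrableOn.union ?_ ?_
  · have hneg' : IntegrableOn (fun t : ℝ => (-1 : ℂ) ^ n *
        ((t : ℂ) ^ (w - 1) • Φ (t • -(x, y)))) (Set.Ioi (-0)) := by
      rw [neg_zero]
      exact hneg.const_mul _
    refine hneg'.comp_neg_Iio.congr_fun (fun t ht => ?_) measurableSet_Iio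
    have ht' : t < 0 := ht
    have h0 : ((-t : ℝ) : ℂ) ≠ 0 := by exact_mod_cast (neg_pos.2 ht').ne'
    simp only [Real.sign_of_neg ht', abs_of_neg ht', Complex.cpow_sub _ _ h0, Complex.cpow_one,
      Prod.smul_mk, Prod.neg_mk, smul_eq_mul, mul_neg, neg_mul, neg_neg]
    push_cast
    ring
  · refine hpos.congr_fun (fun t ht => ?_) measurableSet_Ioi
    have ht' : 0 < t := ht
    have h0 : (t : ℂ) ≠ 0 := by exact_mod_cast ht'.ne'
    simp only [Real.sign_of_pos ht', abs_of_pos ht', Complex.cpow_sub _ _ h0, Complex.cpow_one,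
      Prod.smul_mk, smul_eq_mul]
    push_cast
    ring

theorem sign_pow_mul_self {δ : ℝ} (hδ : δ ≠ 0) (n : ℕ) :
    ((Real.sign δ : ℝ) : ℂ) ^ n * ((Real.sign δ : ℝ) : ℂ) ^ n = 1 := by
  rw [← mul_pow]
  rcases hδ.lt_or_gt with h | h <;> simp [Real.sign_of_neg, Real.sign_of_pos, h]

theorem ofReal_abs_mul_cpow (a b : ℝ) (w : ℂ) :
    ((|a * b| : ℝ) : ℂ) ^ w = ((|a| : ℝ) : ℂ) ^ w * ((|b| : ℝ) : ℂ) ^ w := by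
  rw [abs_mul, Complex.ofReal_mul, Complex.mul_cpow_ofReal_nonneg (abs_nonneg a) (abs_nonneg b)]

/-- The Tate integral of a Schwartz function along a line is homogeneous in the direction. -/
theorem integral_schwartzMap_sign_pow_mul_cpow_scale (n : ℕ) (Φ : SchwartzMap (ℝ × ℝ) ℂ)
    (x y : ℝ) (w : ℂ) {δ : ℝ} (hδ : δ ≠ 0) :
    ∫ t in ({(0 : ℝ)}ᶜ : Set ℝ), Φ (t * (δ * x), t * (δ * y)) * ((Real.sign t : ℝ) : ℂ) ^ n *
        ((|t| : ℝ) : ℂ) ^ w / ((|t| : ℝ) : ℂ) =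
      ((Real.sign δ : ℝ) : ℂ) ^ n * (((|δ| : ℝ) : ℂ) ^ w)⁻¹ *
        ∫ t in ({(0 : ℝ)}ᶜ : Set ℝ), Φ (t * x, t * y) * ((Real.sign t : ℝ) : ℂ) ^ n *
          ((|t| : ℝ) : ℂ) ^ w / ((|t| : ℝ) : ℂ) := by
  have hδ' : ((|δ| : ℝ) : ℂ) ≠ 0 := by exact_mod_cast abs_ne_zero.2 hδ
  have hδw : ((|δ| : ℝ) : ℂ) ^ w ≠ 0 := by simp [Complex.cpow_eq_zero_iff, hδ]
  simp only [restrict_compl_singleton]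
  have key := Measure.integral_comp_mul_left (fun t : ℝ => Φ (t * x, t * y) *
    ((Real.sign t : ℝ) : ℂ) ^ n * ((|t| : ℝ) : ℂ) ^ w / ((|t| : ℝ) : ℂ)) δ
  rw [Complex.real_smul, abs_inv, Complex.ofReal_inv, eq_inv_mul_iff_mul_eq₀ hδ'] at key
  rw [← key, ← integral_const_mul, ← integral_const_mul]
  refine integral_congr_ae (Filter.Eventually.of_forall fun t => ?_)
  have hsign := sign_pow_mul_self hδ n
  simp only [Real.sign_mul, ofReal_abs_mul_cpow, Complex.ofReal_mul, mul_pow]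
  rw [abs_mul, Complex.ofReal_mul, show δ * t * x = t * (δ * x) by ring, show δ * t * y = t * (δ * y) by ring]
  field_simp
  rw [sq, hsign]
  ring

/-- For `Re s > n/2` the integral defining the archimedean section converges absolutely for
every invertible real `g`, and the section transforms under left translation by upper
triangular matrices by the character `χ_{ν₁,ν₂,s}` with `ν₁ = |·|^{−n} sgn(·)^n`, `ν₂ = 1`:
this is the archimedean case of the induced-representation property of `f(g, Φ, ν, s)`. -/
theorem stmt_13 (n : ℕ) (Φ : SchwartzMap (ℝ × ℝ) ℂ) (s : ℂ) (hs : (n : ℝ) / 2 < s.re) :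
    ∀ g : Matrix (Fin 2) (Fin 2) ℝ, g.det ≠ 0 →
      IntegrableOn
        (fun t : ℝ => Φ (t * g 1 0, t * g 1 1) * ((Real.sign t : ℝ) : ℂ) ^ n *
          ((|t| : ℝ) : ℂ) ^ (2 * s - (n : ℂ)) / ((|t| : ℝ) : ℂ)) ({(0 : ℝ)}ᶜ) ∧
      ∀ (α δ β : ℝ), α ≠ 0 → δ ≠ 0 →
        fsec n Φ s (!![α, β; 0, δ] * g)
          = ((Real.sign α : ℝ) : ℂ) ^ n * ((|α| : ℝ) : ℂ) ^ (-(n : ℤ)) *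
              ((|α| / |δ| : ℝ) : ℂ) ^ s * fsec n Φ s g := by
  intro g hg
  have hrow : (g 1 0, g 1 1) ≠ (0 : ℝ × ℝ) := by
    intro h
    obtain ⟨h0, h1⟩ := Prod.mk_eq_zero.1 h
    exact hg (by simp [Matrix.det_fin_two, h0, h1])
  have hw : 0 < (2 * s - (n : ℂ)).re := by
    simp
    linarith
  refine ⟨integrableOn_schwartzMap_sign_pow_mul_cpow n Φ hrow hw, fun α δ β hα hδ => ?_⟩
  have hα' : ((|α| : ℝ) : ℂ) ≠ 0 := by exact_mod_cast abs_ne_zero.2 hα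
  have hδ' : ((|δ| : ℝ) : ℂ) ≠ 0 := by exact_mod_cast abs_ne_zero.2 hδ
  have hδs : ((|δ| : ℝ) : ℂ) ^ s ≠ 0 := by simp [Complex.cpow_eq_zero_iff, hδ]
  have hdet : (!![α, β; 0, δ] * g).det = α * δ * g.det := by
    rw [Matrix.det_mul, Matrix.det_fin_two_of]
    ring
  have h0 : (!![α, β; 0, δ] * g) 1 0 = δ * g 1 0 := by
    simp [Matrix.mul_apply, Fin.sum_univ_two]
  have h1 : (!![α, β; 0, δ] * g) 1 1 = δ * g 1 1 := by
    simp [Matrix.mul_apply, Fin.sum_univ_two]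
  have hdiv : ((|α| / |δ| : ℝ) : ℂ) ^ s = ((|α| : ℝ) : ℂ) ^ s / ((|δ| : ℝ) : ℂ) ^ s := by
    rw [eq_div_iff hδs, ← Complex.mul_cpow_ofReal_nonneg (by positivity) (abs_nonneg δ),
      ← Complex.ofReal_mul, div_mul_cancel₀ _ (abs_ne_zero.2 hδ)]
  have hsign := sign_pow_mul_self hδ n
  rw [fsec, fsec, hdet, h0, h1, integral_schwartzMap_sign_pow_mul_cpow_scale n Φ _ _ _ hδ, hdiv]
  generalize (∫ t in ({(0 : ℝ)}ᶜ : Set ℝ), Φ (t * g 1 0, t * g 1 1) *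
    ((Real.sign t : ℝ) : ℂ) ^ n * ((|t| : ℝ) : ℂ) ^ (2 * s - (n : ℂ)) / ((|t| : ℝ) : ℂ)) = I
  simp only [Real.sign_mul, ofReal_abs_mul_cpow, Complex.ofReal_mul, mul_pow]
  rw [Complex.cpow_sub _ _ hα', Complex.cpow_sub _ _ hδ', Complex.cpow_sub _ _ hδ', two_mul,
    Complex.cpow_add _ _ hδ', Complex.cpow_natCast, Complex.cpow_natCast, _root_.zpow_neg,
    zpow_natCast]
  field_simp
  rw [sq, hsign]
  ring
end
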